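/- arXiv:1702.00057 — 3 statements merged into one kernel-verified Lean document; each statement's English description precedes it below -/
import Mathlib

section
/- Suppose the pair (h,f) is zero-input output-persistently exciting (output-PE) w.r.t. S. Then for any continuous positive definite function α : ℝ≥0 → ℝ≥0, the pair (ĥ, f) with ĥ = α(|h|) is also zero-input output-PE w.r.t. S. -/
open MeasureTheory Set Filter Topology

noncomputable section

/-- A class-`K` function: continuous and strictly increasing on `[0,∞)` with `φ 0 = 0`. -/
def ClassK (φ : ℝ → ℝ) : Prop :=
  ContinuousOn φ (Set.Ici 0) ∧ StrictMonoOn φ (Set.Ici 0) ∧ φ 0 = 0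

/-- A class-`K∞` function: class `K` and unbounded. -/
def ClassKInf (φ : ℝ → ℝ) : Prop :=
  ClassK φ ∧ Filter.Tendsto φ Filter.atTop Filter.atTop

/-- A class-`KL` function: `β (·, t)` is of class `K∞` for each `t ≥ 0` and `β (r, ·)`
decreases monotonically to `0` for each fixed `r ≥ 0`. -/
def ClassKL (β : ℝ → ℝ → ℝ) : Prop :=
  (∀ t, 0 ≤ t → ClassKInf fun r => β r t) ∧
  (∀ r, 0 ≤ r → AntitoneOn (fun t => β r t) (Set.Ici 0) ∧
    Filter.Tendsto (fun t => β r t) Filter.atTop (nhds 0))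

/-- A continuous positive definite function on `[0,∞)`. -/
def PosDefFun (φ : ℝ → ℝ) : Prop :=
  ContinuousOn φ (Set.Ici 0) ∧ φ 0 = 0 ∧ ∀ s, 0 < s → 0 < φ s

variable {Γ : Type*} {E : Type*} {F : Type*} {P : Type*}
  [NormedAddCommGroup E] [NormedSpace ℝ E]
  [NormedAddCommGroup F] [NormedSpace ℝ F]
  [NormedAddCommGroup P]
  [MeasurableSpace E] [MeasurableSpace F] [MeasurableSpace P]

/-- A switching signal: piecewise constant with finitely many discontinuities on every
bounded interval of `[0,∞)`, and right-continuous. -/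
def IsSwitchingSignal (σ : ℝ → Γ) : Prop :=
  ∀ b : ℝ, 0 < b → ∃ (n : ℕ) (t : ℕ → ℝ), t 0 = 0 ∧ (∀ i < n, t i < t (i + 1)) ∧ b ≤ t n ∧
    ∀ i < n, ∀ s ∈ Set.Ico (t i) (t (i + 1)), σ s = σ (t i)

/-- An admissible input: Lebesgue measurable and locally essentially bounded. -/
def IsInput (u : ℝ → F) : Prop :=
  Measurable u ∧ ∀ b : ℝ, ∃ C : ℝ, ∀ᵐ s ∂volume, s ∈ Set.Icc (0 : ℝ) b → ‖u s‖ ≤ C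

/-- A Carathéodory solution of `ẋ = f t x u σ` on the domain `D ⊆ [0,∞)` (an interval):
a continuous function satisfying the corresponding integral equation. -/
structure IsSolution (f : ℝ → E → F → Γ → E) (u : ℝ → F) (σ : ℝ → Γ)
    (D : Set ℝ) (x : ℝ → E) : Prop where
  ordConnected : D.OrdConnected
  subset_Ici : D ⊆ Set.Ici 0
  nonempty : D.Nonempty
  continuousOn : ContinuousOn x D
  intervalIntegrable : ∀ a ∈ D, ∀ b ∈ D,
    IntervalIntegrable (fun s => f s (x s) (u s) (σ s)) volume a b
  integral_eq : ∀ a ∈ D, ∀ b ∈ D, x b = x a + ∫ s in a..b, f s (x s) (u s) (σ s)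

/-- A maximally defined Carathéodory solution: one admitting no proper extension. -/
def IsMaximalSolution (f : ℝ → E → F → Γ → E) (u : ℝ → F) (σ : ℝ → Γ)
    (D : Set ℝ) (x : ℝ → E) : Prop :=
  IsSolution f u σ D x ∧
    ∀ D' : Set ℝ, ∀ x' : ℝ → E, IsSolution f u σ D' x' → D ⊆ D' → Set.EqOn x x' D → D' ⊆ D

/-- Standing regularity assumptions on `f`: vanishing at the origin for zero input,
Lebesgue measurable in `t`, continuous in `(ξ, μ)`. -/
def Regular (f : ℝ → E → F → Γ → E) : Prop :=
  (∀ t, 0 ≤ t → ∀ i, f t 0 0 i = 0) ∧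
  (∀ ξ μ i, Measurable fun t => f t ξ μ i) ∧
  (∀ t i, Continuous fun q : E × F => f t q.1 q.2 i)

/-- Forward completeness w.r.t. `S`. -/
def ForwardComplete (f : ℝ → E → F → Γ → E) (S : Set (ℝ → Γ)) : Prop :=
  ∀ t₀, 0 ≤ t₀ → ∀ u : ℝ → F, IsInput u → ∀ σ ∈ S, ∀ D x,
    IsMaximalSolution f u σ D x → t₀ ∈ D → Set.Ici t₀ ⊆ D

/-- iISS w.r.t. `S` with iISS gain `χ`. -/
def IISS (f : ℝ → E → F → Γ → E) (S : Set (ℝ → Γ)) (χ : ℝ → ℝ) : Prop :=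
  ForwardComplete f S ∧
  ∃ β ρ, ClassKL β ∧ ClassK ρ ∧
    ∀ t₀, 0 ≤ t₀ → ∀ u : ℝ → F, IsInput u → ∀ σ ∈ S, ∀ D x,
      IsMaximalSolution f u σ D x → t₀ ∈ D → ∀ t ∈ D, t₀ ≤ t →
        ‖x t‖ ≤ β ‖x t₀‖ (t - t₀) + ρ (∫ s in t₀..t, χ ‖u s‖)

/-- 0-GUAS w.r.t. `S`. -/
def ZeroGUAS (f : ℝ → E → F → Γ → E) (S : Set (ℝ → Γ)) : Prop :=
  ∃ β, ClassKL β ∧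
    ∀ t₀, 0 ≤ t₀ → ∀ σ ∈ S, ∀ D x,
      IsMaximalSolution f (fun _ => (0 : F)) σ D x → t₀ ∈ D → ∀ t ∈ D, t₀ ≤ t →
        ‖x t‖ ≤ β ‖x t₀‖ (t - t₀)

/-- UBEBS w.r.t. `S` with UBEBS gain `α`. -/
def UBEBS (f : ℝ → E → F → Γ → E) (S : Set (ℝ → Γ)) (α : ℝ → ℝ) : Prop :=
  ∃ α₁ α₂ c, ClassK α₁ ∧ ClassK α₂ ∧ 0 ≤ c ∧
    ∀ t₀, 0 ≤ t₀ → ∀ u : ℝ → F, IsInput u → ∀ σ ∈ S, ∀ D x,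
      IsMaximalSolution f u σ D x → t₀ ∈ D → ∀ t ∈ D, t₀ ≤ t →
        ‖x t‖ ≤ α₁ ‖x t₀‖ + α₂ (∫ s in t₀..t, α ‖u s‖) + c

/-- The total `χ`-energy `∫_0^∞ χ(|u(s)|) ds` of an input, as an extended nonnegative real. -/
def Energy (χ : ℝ → ℝ) (u : ℝ → F) : ENNReal :=
  ∫⁻ s in Set.Ioi (0 : ℝ), ENNReal.ofReal (χ ‖u s‖)

/-- `χ`-BEICS w.r.t. `S`: every solution corresponding to an input of finite `χ`-energy
is defined for all future times and converges to `0`. -/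
def BEICS (f : ℝ → E → F → Γ → E) (S : Set (ℝ → Γ)) (χ : ℝ → ℝ) : Prop :=
  ∀ t₀, 0 ≤ t₀ → ∀ u : ℝ → F, IsInput u → ∀ σ ∈ S, ∀ D x,
    IsMaximalSolution f u σ D x → t₀ ∈ D → Energy χ u ≠ ⊤ →
      Set.Ici t₀ ⊆ D ∧ Filter.Tendsto x Filter.atTop (nhds 0)

/-- Condition (C1) of Assumption A, with the class-`K` function `γ`. -/
def CondC1 (f : ℝ → E → F → Γ → E) (γ : ℝ → ℝ) : Prop :=
  ∃ N : ℝ → ℝ, (∀ r, 0 ≤ r → 0 < N r) ∧ MonotoneOn N (Set.Ici 0) ∧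
    ∀ t, 0 ≤ t → ∀ (ξ : E) (μ : F) (i : Γ), ‖f t ξ μ i‖ ≤ N ‖ξ‖ * (1 + γ ‖μ‖)

/-- Condition (C2) of Assumption A. -/
def CondC2 (f : ℝ → E → F → Γ → E) : Prop :=
  ∀ r, 0 < r → ∀ ε, 0 < ε → ∃ δ, 0 < δ ∧ ∀ t, 0 ≤ t → ∀ (i : Γ) (ξ : E) (μ : F),
    ‖ξ‖ ≤ r → ‖μ‖ ≤ δ → ‖f t ξ μ i - f t ξ 0 i‖ < ε

/-- Condition (C3) of Assumption A: `f (t, ξ, 0, i)` is locally Lipschitz in `ξ`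
uniformly in `t` and `i`. -/
def CondC3 (f : ℝ → E → F → Γ → E) : Prop :=
  ∀ K : Set E, IsCompact K → ∃ L, 0 ≤ L ∧ ∀ t, 0 ≤ t → ∀ (i : Γ), ∀ ξ ∈ K, ∀ ξ' ∈ K,
    ‖f t ξ 0 i - f t ξ' 0 i‖ ≤ L * ‖ξ - ξ'‖

/-- Assumption A, with `γ` the class-`K` function appearing in (C1). -/
def AssumptionA (f : ℝ → E → F → Γ → E) (γ : ℝ → ℝ) : Prop :=
  ClassK γ ∧ CondC1 f γ ∧ CondC2 f ∧ CondC3 f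

/-- Sandwich bounds `φ₁(|ξ|) ≤ V(t,ξ) ≤ φ₂(|ξ|)` with `φ₁, φ₂` of class `K∞`. -/
def StorageBounds (V : ℝ → E → ℝ) : Prop :=
  ∃ φ₁ φ₂, ClassKInf φ₁ ∧ ClassKInf φ₂ ∧
    ∀ t, 0 ≤ t → ∀ ξ : E, φ₁ ‖ξ‖ ≤ V t ξ ∧ V t ξ ≤ φ₂ ‖ξ‖

/-- 0-OD (zero-output dissipativity) w.r.t. `S` witnessed by the storage function `V`
and the supply function `α`. -/
def ZeroODWithStorage (f : ℝ → E → F → Γ → E) (S : Set (ℝ → Γ)) (V : ℝ → E → ℝ)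
    (α : ℝ → ℝ) : Prop :=
  StorageBounds V ∧
    ∀ t₀, 0 ≤ t₀ → ∀ u : ℝ → F, IsInput u → ∀ σ ∈ S, ∀ D x,
      IsMaximalSolution f u σ D x → t₀ ∈ D → ∀ t ∈ D, t₀ ≤ t →
        V t (x t) ≤ V t₀ (x t₀) + ∫ s in t₀..t, α ‖u s‖

/-- 0-OD w.r.t. `S` with supply function `α`. -/
def ZeroOD (f : ℝ → E → F → Γ → E) (S : Set (ℝ → Γ)) (α : ℝ → ℝ) : Prop :=
  ∃ V : ℝ → E → ℝ, (∀ t ξ, 0 ≤ V t ξ) ∧ ZeroODWithStorage f S V α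

/-- `h`-OD (output dissipativity) w.r.t. `S` with supply function `α`. -/
def HOD (f : ℝ → E → F → Γ → E) (h : ℝ → E → F → Γ → P) (S : Set (ℝ → Γ))
    (α : ℝ → ℝ) : Prop :=
  ∃ V : ℝ → E → ℝ, (∀ t ξ, 0 ≤ V t ξ) ∧ StorageBounds V ∧
    ∃ α₃, PosDefFun α₃ ∧
      ∀ t₀, 0 ≤ t₀ → ∀ u : ℝ → F, IsInput u → ∀ σ ∈ S, ∀ D x,
        IsMaximalSolution f u σ D x → t₀ ∈ D → ∀ t ∈ D, t₀ ≤ t →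
          V t (x t) ≤ V t₀ (x t₀) - (∫ s in t₀..t, α₃ ‖h s (x s) (u s) (σ s)‖)
            + ∫ s in t₀..t, α ‖u s‖

/-- The pair `(h, f)` is zero-input output-persistently exciting w.r.t. `S`. -/
def OutputPE (f : ℝ → E → F → Γ → E) (h : ℝ → E → F → Γ → P)
    (S : Set (ℝ → Γ)) : Prop :=
  ∀ ε : ℝ, 0 < ε → ε ≤ 1 → ∃ T, 0 < T ∧ ∃ r, 0 < r ∧
    ∀ t₀, 0 ≤ t₀ → ∀ σ ∈ S, ∀ D x,
      IsMaximalSolution f (fun _ => (0 : F)) σ D x → t₀ ∈ D →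
        ∀ t, t₀ ≤ t → Set.Icc t (t + T) ⊆ D →
          (∀ τ ∈ Set.Icc t (t + T), ε ≤ ‖x τ‖ ∧ ‖x τ‖ ≤ 1 / ε) →
            r ≤ ∫ τ in t..(t + T), ‖h τ (x τ) 0 (σ τ)‖ ^ 2

/-- Standing regularity assumptions on the output map `h`. -/
def OutputRegular (h : ℝ → E → F → Γ → P) : Prop :=
  (∀ ξ μ i, Measurable fun t => h t ξ μ i) ∧
  (∀ t i, Continuous fun q : E × F => h t q.1 q.2 i) ∧
  ∀ K : Set E, IsCompact K → (0 : E) ∉ K → ∃ M : ℝ,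
    ∀ᵐ t ∂volume, 0 ≤ t → ∀ ξ ∈ K, ∀ i : Γ, ‖h t ξ 0 i‖ ≤ M

/-- On a bounded interval, the square of a positive definite function dominates a positive
multiple of `s ^ 2 - δ`. -/
theorem PosDefFun.exists_mul_sq_sub_le {α : ℝ → ℝ} (hα : PosDefFun α) (M : ℝ) {δ : ℝ}
    (hδ : 0 < δ) :
    ∃ c, 0 < c ∧ ∀ s ∈ Set.Icc 0 M, c * (s ^ 2 - δ) ≤ α s ^ 2 := by
  obtain ⟨hcont, -, hpos⟩ := hα
  have hcompact : IsCompact (Set.Icc 0 M ∩ {s : ℝ | δ ≤ s ^ 2}) :=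
    isCompact_Icc.inter_right (isClosed_le continuous_const (continuous_pow 2))
  rcases (Set.Icc 0 M ∩ {s : ℝ | δ ≤ s ^ 2}).eq_empty_or_nonempty with hempty | hne
  · refine ⟨1, one_pos, fun s hs => ?_⟩
    have hlt : s ^ 2 < δ := by
      by_contra! hle
      have hmem : s ∈ Set.Icc 0 M ∩ {s : ℝ | δ ≤ s ^ 2} := ⟨hs, hle⟩
      simp [hempty] at hmem
    nlinarith [sq_nonneg (α s)]
  · obtain ⟨s₀, ⟨hs₀, hδs₀⟩, hmin⟩ := hcompact.exists_isMinOn hne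
      ((hcont.pow 2).mono fun s hs => hs.1.1)
    have hs₀pos : 0 < s₀ := by
      refine lt_of_le_of_ne hs₀.1 fun heq => ?_
      simp only [Set.mem_ofPred_eq, ← heq] at hδs₀
      norm_num at hδs₀
      exact hδs₀.not_gt hδ
    have ha : 0 < α s₀ ^ 2 := pow_pos (hpos s₀ hs₀pos) 2
    have hM : 0 < M ^ 2 := pow_pos (hs₀pos.trans_le hs₀.2) 2
    refine ⟨α s₀ ^ 2 / M ^ 2, by positivity, fun s hs => ?_⟩
    rcases le_or_gt δ (s ^ 2) with hle | hlt
    · have hsM : s ^ 2 - δ ≤ M ^ 2 := by nlinarith [hs.1, hs.2]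
      calc α s₀ ^ 2 / M ^ 2 * (s ^ 2 - δ) ≤ α s₀ ^ 2 / M ^ 2 * M ^ 2 := by gcongr
        _ = α s₀ ^ 2 := div_mul_cancel₀ _ hM.ne.symm
        _ ≤ α s ^ 2 := hmin ⟨hs, hle⟩
    · have hc : 0 < α s₀ ^ 2 / M ^ 2 := by positivity
      nlinarith [sq_nonneg (α s)]

/-- Composing an essentially bounded nonnegative function with a function continuous on `[0,∞)`
gives an integrable square with respect to a finite measure. -/
theorem ContinuousOn.integrable_sq_comp_of_ae_mem_Icc {X : Type*} [MeasurableSpace X]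
    {μ : Measure X} [IsFiniteMeasure μ] {α : ℝ → ℝ} (hα : ContinuousOn α (Set.Ici 0))
    {g : X → ℝ} {M : ℝ} (hg : AEStronglyMeasurable g μ) (hgM : ∀ᵐ x ∂μ, g x ∈ Set.Icc 0 M) :
    Integrable (fun x => α (g x) ^ 2) μ := by
  obtain ⟨C, hC⟩ := isCompact_Icc.exists_bound_of_continuousOn
    ((hα.pow 2).mono fun s (hs : s ∈ Set.Icc 0 M) => hs.1)
  have hext : Continuous fun s => α (max s 0) :=
    hα.comp_continuous (continuous_id.max continuous_const) fun s => le_max_right s 0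
  refine Integrable.of_bound (C := C) ?_ (hgM.mono fun x hx => hC _ hx)
  refine ((hext.pow 2).comp_aestronglyMeasurable hg).congr (hgM.mono fun x hx => ?_)
  simp [max_eq_left hx.1]

/-- Lemma `ope`: if the pair `(h, f)` is zero-input output-PE w.r.t. `S`,
then for any continuous positive definite function `α`, the pair `(ĥ, f)` with
`ĥ = α(|h|)` is also zero-input output-PE w.r.t. `S`. -/
theorem stmt14 {n m p : ℕ} {Γ : Type*} [Nonempty Γ]
    (f : ℝ → EuclideanSpace ℝ (Fin n) → EuclideanSpace ℝ (Fin m) → Γ → EuclideanSpace ℝ (Fin n))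
    (h : ℝ → EuclideanSpace ℝ (Fin n) → EuclideanSpace ℝ (Fin m) → Γ → EuclideanSpace ℝ (Fin p))
    (hreg : Regular f) (hhreg : OutputRegular h)
    (S : Set (ℝ → Γ)) (hS : ∀ σ ∈ S, IsSwitchingSignal σ)
    (hPE : OutputPE f h S)
    (α : ℝ → ℝ) (hα : PosDefFun α) :
    OutputPE f (fun t ξ μ i => α ‖h t ξ μ i‖) S := by
  intro ε hε hε1
  obtain ⟨T, hT, r, hr, hTr⟩ := hPE ε hε hε1
  obtain ⟨M, hM⟩ := hhreg.2.2 (Metric.closedBall 0 (1 / ε) ∩ {ξ | ε ≤ ‖ξ‖})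
    ((isCompact_closedBall 0 (1 / ε)).inter_right (isClosed_le continuous_const continuous_norm))
    (fun h0 => hε.not_ge (by simpa using h0.2))
  obtain ⟨c, hc, hcα⟩ := hα.exists_mul_sq_sub_le M (δ := r / (2 * T)) (by positivity)
  refine ⟨T, hT, c * (r / 2), by positivity, fun t₀ ht₀ σ hσ D x hx ht₀D t ht hD hbd => ?_⟩
  have hle : t ≤ t + T := by linarith
  have hPEr := hTr t₀ ht₀ σ hσ D x hx ht₀D t ht hD hbd
  rw [intervalIntegral.integral_of_le hle] at hPEr ⊢
  simp only [Real.norm_eq_abs, sq_abs]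
  set μ := volume.restrict (Set.Ioc t (t + T)) with hμ
  set g : ℝ → ℝ := fun τ => ‖h τ (x τ) 0 (σ τ)‖ with hg
  have hgM : ∀ᵐ τ ∂μ, g τ ∈ Set.Icc 0 M := by
    filter_upwards [ae_restrict_of_ae hM, ae_restrict_mem measurableSet_Ioc] with τ hτ hmem
    have hb := hbd τ (Set.Ioc_subset_Icc_self hmem)
    exact ⟨norm_nonneg _, hτ (by linarith [hmem.1]) (x τ) ⟨by simpa using hb.2, hb.1⟩ (σ τ)⟩
  have hgint : Integrable (fun τ => g τ ^ 2) μ := by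
    by_contra hni
    exact hr.not_ge (hPEr.trans_eq (integral_undef hni))
  have hgmeas : AEStronglyMeasurable g μ :=
    (Real.continuous_sqrt.comp_aestronglyMeasurable hgint.aestronglyMeasurable).congr
      (ae_of_all _ fun τ => Real.sqrt_sq (norm_nonneg _))
  calc c * (r / 2) = c * (r - r / (2 * T) * T) := by field_simp; ring
    _ ≤ c * ((∫ τ, g τ ^ 2 ∂μ) - r / (2 * T) * T) := by gcongr
    _ = ∫ τ, c * (g τ ^ 2 - r / (2 * T)) ∂μ := by
      rw [integral_const_mul, integral_sub hgint (integrable_const _)]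
      simp [hμ, hT.le, mul_comm]
    _ ≤ ∫ τ, α (g τ) ^ 2 ∂μ :=
      integral_mono_ae ((hgint.sub (integrable_const _)).const_mul c)
        (hα.1.integrable_sq_comp_of_ae_mem_Icc hgmeas hgM) (hgM.mono fun τ hτ => hcα _ hτ)
end
end

section
/- If the switched system ẋ = f(t,x,u,σ) is 0-OD (zero-output dissipative) w.r.t. a set S of switching signals, then it is 0-OD w.r.t. S♯, the set of all switching signals obtained by concatenating finitely many (at least two) switching signals from S; moreover the same storage function V and supply function α witness the 0-OD property w.r.t. S♯. -/
open MeasureTheory Set Filter Topology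

noncomputable section

variable {Γ : Type*} {E : Type*} {F : Type*} {P : Type*}
  [NormedAddCommGroup E] [NormedSpace ℝ E]
  [NormedAddCommGroup F] [NormedSpace ℝ F]
  [NormedAddCommGroup P]
  [MeasurableSpace E] [MeasurableSpace F] [MeasurableSpace P]

/-- `σ` is a concatenation of finitely many (at least two) switching signals from `S`:
there are `σ₁, …, σ_k ∈ S` (`k ≥ 2`) and times `0 < t₁ < … < t_{k−1}` such that `σ` equals
`σ₁` on `(−∞, t₁)`, `σ_{j+1}` on `[t_j, t_{j+1})` and `σ_k` on `[t_{k−1}, ∞)`. -/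
def IsFiniteConcat {Γ : Type*} (S : Set (ℝ → Γ)) (σ : ℝ → Γ) : Prop :=
  ∃ k : ℕ, 2 ≤ k ∧ ∃ σs : ℕ → ℝ → Γ, ∃ ts : ℕ → ℝ,
    (∀ j, 1 ≤ j → j ≤ k → σs j ∈ S) ∧
    0 < ts 1 ∧
    (∀ j, 1 ≤ j → j + 1 ≤ k - 1 → ts j < ts (j + 1)) ∧
    (∀ s, s < ts 1 → σ s = σs 1 s) ∧
    (∀ j, 1 ≤ j → j ≤ k - 2 → ∀ s, ts j ≤ s → s < ts (j + 1) → σ s = σs (j + 1) s) ∧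
    (∀ s, ts (k - 1) ≤ s → σ s = σs k s)

/-- Restricting a solution to a subinterval, and modifying the trajectory off that subinterval and
the switching signal on a null set, yields again a solution. -/
lemma IsSolution.congr_of_subset {f : ℝ → E → F → Γ → E} {u : ℝ → F} {σ σ' : ℝ → Γ}
    {D D' : Set ℝ} {x y : ℝ → E} (h : IsSolution f u σ D x) (hsub : D' ⊆ D)
    (hne : D'.Nonempty) (hord : D'.OrdConnected) (hxy : EqOn x y D')
    (hσ : ∀ᵐ s ∂volume, s ∈ D' → σ s = σ' s) : IsSolution f u σ' D' y := by
  have key : ∀ a ∈ D', ∀ b ∈ D', ∀ᵐ s ∂volume, s ∈ uIoc a b →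
      f s (x s) (u s) (σ s) = f s (y s) (u s) (σ' s) := by
    intro a ha b hb
    filter_upwards [hσ] with s hs hsab
    have hsD : s ∈ D' := hord.uIcc_subset ha hb (uIoc_subset_uIcc hsab)
    rw [hs hsD, hxy hsD]
  refine ⟨hord, hsub.trans h.subset_Ici, hne, (h.continuousOn.mono hsub).congr hxy.symm, ?_, ?_⟩
  · intro a ha b hb
    exact (h.intervalIntegrable a (hsub ha) b (hsub hb)).congr_ae
      ((ae_restrict_iff' measurableSet_uIoc).2 (key a ha b hb))
  · intro a ha b hb
    rw [← hxy ha, ← hxy hb, h.integral_eq a (hsub ha) b (hsub hb),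
      intervalIntegral.integral_congr_ae (key a ha b hb)]

/-- A function is continuous on a set of reals if it is continuous on each segment
with endpoints in the set. -/
lemma continuousOn_of_forall_Icc {X : Type*} [TopologicalSpace X] {D : Set ℝ} {x : ℝ → X}
    (h : ∀ a ∈ D, ∀ b ∈ D, ContinuousOn x (Icc a b)) : ContinuousOn x D := by
  intro p hp
  have hR : ContinuousWithinAt x (D ∩ Ici p) p := by
    by_cases hq : ∃ q ∈ D, p < q
    · obtain ⟨q, hq, hpq⟩ := hq
      have h1 := h p hp q hq p ⟨le_rfl, hpq.le⟩
      refine h1.mono_of_mem_nhdsWithin ?_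
      filter_upwards [self_mem_nhdsWithin, mem_nhdsWithin_of_mem_nhds (Iio_mem_nhds hpq)]
        with s hs hs' using ⟨hs.2, le_of_lt hs'⟩
    · push Not at hq
      exact continuousWithinAt_singleton.mono fun s hs => le_antisymm (hq s hs.1) hs.2
  have hL : ContinuousWithinAt x (D ∩ Iic p) p := by
    by_cases hq : ∃ q ∈ D, q < p
    · obtain ⟨q, hq, hpq⟩ := hq
      have h1 := h q hq p hp p ⟨hpq.le, le_rfl⟩
      refine h1.mono_of_mem_nhdsWithin ?_
      filter_upwards [self_mem_nhdsWithin, mem_nhdsWithin_of_mem_nhds (Ioi_mem_nhds hpq)]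
        with s hs hs' using ⟨le_of_lt hs', hs.2⟩
    · push Not at hq
      exact continuousWithinAt_singleton.mono fun s hs => le_antisymm hs.2 (hq s hs.1)
  refine (hL.union hR).mono fun s hs => ?_
  rcases le_total s p with hsp | hsp
  · exact Or.inl ⟨hs, hsp⟩
  · exact Or.inr ⟨hs, hsp⟩

/-- A nonempty chain of solutions, ordered by extension, has an upper bound. -/
lemma exists_isSolution_of_isChain {f : ℝ → E → F → Γ → E} {u : ℝ → F} {σ : ℝ → Γ}
    {c : Set (Set ℝ × (ℝ → E))} (hne : c.Nonempty) (hsol : ∀ p ∈ c, IsSolution f u σ p.1 p.2)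
    (hc : IsChain (fun p q => p.1 ⊆ q.1 ∧ EqOn p.2 q.2 p.1) c) :
    ∃ D x, IsSolution f u σ D x ∧ ∀ p ∈ c, p.1 ⊆ D ∧ EqOn p.2 x p.1 := by
  classical
  have htot : ∀ p ∈ c, ∀ q ∈ c,
      (p.1 ⊆ q.1 ∧ EqOn p.2 q.2 p.1) ∨ (q.1 ⊆ p.1 ∧ EqOn q.2 p.2 q.1) := by
    intro p hp q hq
    by_cases hpq : p = q
    · subst hpq
      exact Or.inl ⟨Subset.rfl, fun _ _ => rfl⟩
    · exact hc hp hq hpq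
  let D : Set ℝ := {t | ∃ p ∈ c, t ∈ p.1}
  let x : ℝ → E := fun t => if ht : ∃ p ∈ c, t ∈ p.1 then ht.choose.2 t else 0
  have hsub : ∀ p ∈ c, p.1 ⊆ D := fun p hp t ht => ⟨p, hp, ht⟩
  have heq : ∀ p ∈ c, EqOn p.2 x p.1 := by
    intro p hp t ht
    have hex : ∃ p ∈ c, t ∈ p.1 := ⟨p, hp, ht⟩
    have hx : x t = hex.choose.2 t := dif_pos hex
    rw [hx]
    rcases htot p hp _ hex.choose_spec.1 with h | h
    · exact h.2 ht
    · exact (h.2 hex.choose_spec.2).symm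
  have hx : ∀ p ∈ c, IsSolution f u σ p.1 x := fun p hp =>
    (hsol p hp).congr_of_subset Subset.rfl (hsol p hp).nonempty (hsol p hp).ordConnected
      (heq p hp) (Eventually.of_forall fun _ _ => rfl)
  have hpair : ∀ a ∈ D, ∀ b ∈ D, ∃ p ∈ c, a ∈ p.1 ∧ b ∈ p.1 := by
    rintro a ⟨p, hp, hap⟩ b ⟨q, hq, hbq⟩
    rcases htot p hp q hq with h | h
    · exact ⟨q, hq, h.1 hap, hbq⟩
    · exact ⟨p, hp, hap, h.1 hbq⟩
  refine ⟨D, x, ⟨⟨?_⟩, ?_, ?_, ?_, ?_, ?_⟩, fun p hp => ⟨hsub p hp, heq p hp⟩⟩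
  · intro a ha b hb
    obtain ⟨p, hp, hap, hbp⟩ := hpair a ha b hb
    exact ((hx p hp).ordConnected.out hap hbp).trans (hsub p hp)
  · rintro t ⟨p, hp, ht⟩
    exact (hx p hp).subset_Ici ht
  · obtain ⟨p, hp⟩ := hne
    exact (hx p hp).nonempty.mono (hsub p hp)
  · refine continuousOn_of_forall_Icc fun a ha b hb => ?_
    obtain ⟨p, hp, hap, hbp⟩ := hpair a ha b hb
    exact (hx p hp).continuousOn.mono ((hx p hp).ordConnected.out hap hbp)
  · intro a ha b hb
    obtain ⟨p, hp, hap, hbp⟩ := hpair a ha b hb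
    exact (hx p hp).intervalIntegrable a hap b hbp
  · intro a ha b hb
    obtain ⟨p, hp, hap, hbp⟩ := hpair a ha b hb
    exact (hx p hp).integral_eq a hap b hbp

/-- Every solution extends to a maximal one. -/
lemma IsSolution.exists_isMaximalSolution {f : ℝ → E → F → Γ → E} {u : ℝ → F} {σ : ℝ → Γ}
    {D : Set ℝ} {x : ℝ → E} (h : IsSolution f u σ D x) :
    ∃ D' x', IsMaximalSolution f u σ D' x' ∧ D ⊆ D' ∧ EqOn x x' D := by
  let r : Set ℝ × (ℝ → E) → Set ℝ × (ℝ → E) → Prop := fun p q => p.1 ⊆ q.1 ∧ EqOn p.2 q.2 p.1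
  have rtrans : ∀ {p q w}, r p q → r q w → r p w := fun hpq hqw =>
    ⟨hpq.1.trans hqw.1, hpq.2.trans (hqw.2.mono hpq.1)⟩
  let A := {p : Set ℝ × (ℝ → E) // IsSolution f u σ p.1 p.2 ∧ r (D, x) p}
  obtain ⟨⟨⟨D', x'⟩, hsol, hext⟩, hmax⟩ :=
      exists_maximal_of_chains_bounded (α := A) (r := fun p q => r p.1 q.1) (by
    intro c hc
    rcases c.eq_empty_or_nonempty with rfl | hne
    · exact ⟨⟨(D, x), h, Subset.rfl, fun _ _ => rfl⟩, by simp⟩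
    · obtain ⟨D₁, x₁, hsol, hub⟩ := exists_isSolution_of_isChain (c := Subtype.val '' c)
        (hne.image _) (by rintro _ ⟨p, -, rfl⟩; exact p.2.1)
        (by
          rintro _ ⟨p, hp, rfl⟩ _ ⟨q, hq, rfl⟩ hpq
          exact hc hp hq fun e => hpq (congrArg _ e))
      obtain ⟨p, hp⟩ := hne
      exact ⟨⟨(D₁, x₁), hsol, rtrans p.2.2 (hub p ⟨p, hp, rfl⟩)⟩,
        fun q hq => hub q ⟨q, hq, rfl⟩⟩) (fun hpq hqw => rtrans hpq hqw)
  refine ⟨D', x', ⟨hsol, fun D₂ x₂ h₂ hD hx => ?_⟩, hext⟩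
  exact (hmax ⟨(D₂, x₂), h₂, rtrans hext ⟨hD, hx⟩⟩ ⟨hD, hx⟩).1

/-- The dissipation inequality holds along any segment of a solution on which the switching
signal agrees with a member of `S`. -/
lemma ZeroODWithStorage.le_of_eqOn {f : ℝ → E → F → Γ → E} {S : Set (ℝ → Γ)} {V : ℝ → E → ℝ}
    {α : ℝ → ℝ} (hOD : ZeroODWithStorage f S V α) {u : ℝ → F} (hu : IsInput u)
    {σ σ' : ℝ → Γ} (hσ' : σ' ∈ S) {D : Set ℝ} {x : ℝ → E} (hx : IsSolution f u σ D x)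
    {a b : ℝ} (ha : a ∈ D) (hb : b ∈ D) (hab : a ≤ b) (hσ : EqOn σ σ' (Ico a b)) :
    V b (x b) ≤ V a (x a) + ∫ s in a..b, α ‖u s‖ := by
  have hsol : IsSolution f u σ' (Icc a b) x := by
    refine hx.congr_of_subset (hx.ordConnected.out ha hb) (nonempty_Icc.2 hab) ordConnected_Icc
      (fun _ _ => rfl) ?_
    filter_upwards [Measure.ae_ne volume b] with s hs hsab
    exact hσ ⟨hsab.1, lt_of_le_of_ne hsab.2 hs⟩
  obtain ⟨D', x', hmax, hsub, heq⟩ := hsol.exists_isMaximalSolution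
  have haI : a ∈ Icc a b := ⟨le_rfl, hab⟩
  have hbI : b ∈ Icc a b := ⟨hab, le_rfl⟩
  rw [heq haI, heq hbI]
  exact hOD.2 a (hx.subset_Ici ha) u hu σ' hσ' D' x' hmax (hsub haI) b (hsub hbI) hab

/-- The supply rate along an admissible input is locally integrable on `[0,∞)`. -/
lemma IsInput.intervalIntegrable_classK [OpensMeasurableSpace F] {α : ℝ → ℝ} (hα : ClassK α)
    {u : ℝ → F} (hu : IsInput u) {a b : ℝ} (ha : 0 ≤ a) (hab : a ≤ b) :
    IntervalIntegrable (fun s => α ‖u s‖) volume a b := by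
  obtain ⟨C, hC⟩ := hu.2 b
  obtain ⟨hcont, hmono, h0⟩ := hα
  have hmeas : Measurable fun s => α ‖u s‖ := by
    have hα' : Continuous fun r : ℝ => α (max r 0) :=
      hcont.comp_continuous (by fun_prop) fun r => le_max_right r 0
    have := hα'.measurable.comp hu.1.norm
    simpa [Function.comp_def] using this
  refine (intervalIntegrable_const (c := α (max C 0))).mono_fun hmeas.aestronglyMeasurable ?_
  rw [EventuallyLE, ae_restrict_iff' measurableSet_uIoc]
  filter_upwards [hC] with s hs hsab
  rw [uIoc_of_le hab] at hsab
  have hle : ‖u s‖ ≤ max C 0 := (hs ⟨ha.trans hsab.1.le, hsab.2⟩).trans (le_max_left _ _)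
  have hn : 0 ≤ α ‖u s‖ := h0 ▸ hmono.monotoneOn (mem_Ici.2 le_rfl) (norm_nonneg (u s))
    (norm_nonneg (u s))
  have hαle : α ‖u s‖ ≤ α (max C 0) :=
    hmono.monotoneOn (norm_nonneg (u s)) (le_max_right C 0) hle
  rw [Real.norm_of_nonneg hn, Real.norm_of_nonneg (hn.trans hαle)]
  exact hαle

/-- The dissipation inequality up to time `T` propagates past `T` as long as the switching signal
agrees with a member of `S`. -/
lemma ZeroODWithStorage.le_of_le_of_eqOn [OpensMeasurableSpace F] {f : ℝ → E → F → Γ → E}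
    {S : Set (ℝ → Γ)} {V : ℝ → E → ℝ} {α : ℝ → ℝ} (hα : ClassK α)
    (hOD : ZeroODWithStorage f S V α) {u : ℝ → F} (hu : IsInput u) {σ σ' : ℝ → Γ} (hσ' : σ' ∈ S)
    {D : Set ℝ} {x : ℝ → E} (hx : IsSolution f u σ D x) {t₀ T t : ℝ} (ht₀ : t₀ ∈ D) (ht : t ∈ D)
    (h : t₀ ≤ t) (hσ : EqOn σ σ' (Ico T t))
    (hT : ∀ s ∈ D, t₀ ≤ s → s ≤ T → V s (x s) ≤ V t₀ (x t₀) + ∫ r in t₀..s, α ‖u r‖) :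
    V t (x t) ≤ V t₀ (x t₀) + ∫ r in t₀..t, α ‖u r‖ := by
  rcases le_total t T with htT | hTt
  · exact hT t ht h htT
  rcases le_total T t₀ with hTt₀ | ht₀T
  · exact hOD.le_of_eqOn hu hσ' hx ht₀ ht h (hσ.mono (Ico_subset_Ico_left hTt₀))
  have hTD : T ∈ D := hx.ordConnected.out ht₀ ht ⟨ht₀T, hTt⟩
  have h₁ := hT T hTD ht₀T le_rfl
  have h₂ := hOD.le_of_eqOn hu hσ' hx hTD ht hTt hσ
  have hadd := intervalIntegral.integral_add_adjacent_intervals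
    (hu.intervalIntegrable_classK hα (hx.subset_Ici ht₀) ht₀T)
    (hu.intervalIntegrable_classK hα (hx.subset_Ici hTD) hTt)
  linarith

/-- Lemma `concatenation`: if the system is 0-OD w.r.t. `S`, witnessed by
the storage function `V` and the supply function `α`, then it is 0-OD w.r.t. the set `S♯` of
all finite concatenations of signals from `S`, with the same witnesses `V` and `α`. -/
theorem stmt15 {n m : ℕ} {Γ : Type*} [Nonempty Γ]
    (f : ℝ → EuclideanSpace ℝ (Fin n) → EuclideanSpace ℝ (Fin m) → Γ → EuclideanSpace ℝ (Fin n))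
    (hreg : Regular f)
    (S : Set (ℝ → Γ)) (hS : ∀ σ ∈ S, IsSwitchingSignal σ)
    (V : ℝ → EuclideanSpace ℝ (Fin n) → ℝ) (hV : ∀ t ξ, 0 ≤ V t ξ)
    (α : ℝ → ℝ) (hα : ClassK α)
    (hOD : ZeroODWithStorage f S V α) :
    ZeroODWithStorage f {σ | IsFiniteConcat S σ} V α := by
  refine ⟨hOD.1, ?_⟩
  rintro t₀ - u hu σ ⟨k, hk, σs, ts, hmem, -, -, hfirst, hmid, hlast⟩ D x ⟨hx, -⟩ ht₀ t ht h
  have hind : ∀ j, 1 ≤ j → j ≤ k - 1 → ∀ s ∈ D, t₀ ≤ s → s ≤ ts j →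
      V s (x s) ≤ V t₀ (x t₀) + ∫ r in t₀..s, α ‖u r‖ := by
    intro j hj
    induction j, hj using Nat.le_induction with
    | base =>
      intro _ s hs hs₀ hsT
      exact hOD.le_of_eqOn hu (hmem 1 le_rfl (by omega)) hx ht₀ hs hs₀
        fun r hr => hfirst r (hr.2.trans_le hsT)
    | succ j hj ih =>
      intro hjk s hs hs₀ hsT
      exact hOD.le_of_le_of_eqOn hα hu (hmem (j + 1) (by omega) (by omega)) hx ht₀ hs hs₀
        (fun r hr => hmid j hj (by omega) r hr.1 (hr.2.trans_le hsT)) (ih (by omega))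
  exact hOD.le_of_le_of_eqOn hα hu (hmem k (by omega) le_rfl) hx ht₀ ht h
    (fun r hr => hlast r hr.1) (hind (k - 1) (by omega) le_rfl)
end
end

section
/- There exist a switched system ẋ = f(t,x,u,σ) and a set S of switching signals such that the system is iISS w.r.t. S but not 0-OD w.r.t. S. Concretely, the two-mode switched linear system ẋ = A_σ x + b_σ u in ℝ² with A₁ = [[−1, −100], [10, −1]], A₂ = A₁ᵀ, b₁ = b₂ = (1, 0)ᵀ, and S = {σ₁, σ₂} where σ_i(t) = i for all t ≥ 0, is iISS w.r.t. S but is not 0-OD w.r.t. S. -/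
open MeasureTheory Set Filter Topology

noncomputable section

variable {Γ : Type*} {E : Type*} {F : Type*} {P : Type*}
  [NormedAddCommGroup E] [NormedSpace ℝ E]
  [NormedAddCommGroup F] [NormedSpace ℝ F]
  [NormedAddCommGroup P]
  [MeasurableSpace E] [MeasurableSpace F] [MeasurableSpace P]

open Matrix

/-- The matrices of the two linear modes: `A 0 = A₁ = [[−1, −100], [10, −1]]`, `A 1 = A₂ = A₁ᵀ`. -/
def exA : Fin 2 → Matrix (Fin 2) (Fin 2) ℝ :=
  ![!![(-1 : ℝ), -100; 10, -1], (!![(-1 : ℝ), -100; 10, -1])ᵀ]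

/-- `b₁ = b₂ = (1, 0)ᵀ`. -/
def exb : Fin 2 → ℝ := ![1, 0]

/-- The two-mode switched linear system `ẋ = A_σ x + b_σ u` of Proposition `onlysuff`. -/
noncomputable def exf : ℝ → EuclideanSpace ℝ (Fin 2) → ℝ → Fin 2 → EuclideanSpace ℝ (Fin 2) :=
  fun _ ξ μ i => (EuclideanSpace.equiv (Fin 2) ℝ).symm
    ((exA i).mulVec (EuclideanSpace.equiv (Fin 2) ℝ ξ) + μ • exb)

/-- The set of admissible switching signals: the two constant signals. -/
def exS : Set (ℝ → Fin 2) := {fun _ => 0, fun _ => 1}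

/-- Solutions are carried to solutions by a continuous linear map intertwining the fields. -/
theorem IsSolution.map_clm {X Y M M' I J : Type*}
    [NormedAddCommGroup X] [NormedSpace ℝ X] [CompleteSpace X]
    [NormedAddCommGroup Y] [NormedSpace ℝ Y] [CompleteSpace Y]
    {f : ℝ → X → M → I → X} {g : ℝ → Y → M' → J → Y} {u : ℝ → M} {v : ℝ → M'}
    {σ : ℝ → I} {τ : ℝ → J} {D : Set ℝ} {x : ℝ → X} (hx : IsSolution f u σ D x)
    (L : X →L[ℝ] Y)
    (hL : ∀ s, 0 ≤ s → ∀ ξ, L (f s ξ (u s) (σ s)) = g s (L ξ) (v s) (τ s)) :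
    IsSolution g v τ D (fun t => L (x t)) := by
  have key : ∀ a ∈ D, ∀ b ∈ D, EqOn (fun s => L (f s (x s) (u s) (σ s)))
      (fun s => g s (L (x s)) (v s) (τ s)) (uIcc a b) := fun a ha b hb s hs =>
    hL s (hx.subset_Ici (hx.ordConnected.uIcc_subset ha hb hs)) (x s)
  refine ⟨hx.ordConnected, hx.subset_Ici, hx.nonempty, L.continuous.comp_continuousOn
    hx.continuousOn, fun a ha b hb => ?_, fun a ha b hb => ?_⟩
  · have h := hx.intervalIntegrable a ha b hb
    have h' : IntervalIntegrable (fun s => L (f s (x s) (u s) (σ s))) volume a b :=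
      ⟨L.integrable_comp h.1, L.integrable_comp h.2⟩
    exact h'.congr ((key a ha b hb).mono uIoc_subset_uIcc)
  · rw [← intervalIntegral.integral_congr (key a ha b hb),
      L.intervalIntegral_comp_comm (hx.intervalIntegrable a ha b hb), ← map_add,
      ← hx.integral_eq a ha b hb]

/-- The restriction of an admissible input to `[0,∞)`, extended by zero, is locally integrable. -/
theorem IsInput.intervalIntegrable_indicator {u : ℝ → ℝ} (hu : IsInput u) (a b : ℝ) :
    IntervalIntegrable ((Ici (0 : ℝ)).indicator u) volume a b := by
  obtain ⟨C, hC⟩ := hu.2 (max a b)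
  refine intervalIntegrable_iff.2 (Measure.integrableOn_of_bounded (M := max C 0) (by simp)
    (hu.1.indicator measurableSet_Ici).aestronglyMeasurable ?_)
  refine (ae_restrict_iff' measurableSet_uIoc).2 ?_
  filter_upwards [hC] with s hs hsab
  by_cases h0 : s ∈ Ici (0 : ℝ)
  · rw [indicator_of_mem h0]
    exact (hs ⟨h0, hsab.2⟩).trans (le_max_left _ _)
  · simp [indicator_of_notMem h0]

/-- The complex scalar linear control system `ż = lam z + c u`. -/
def scalarField (lam c : ℂ) : ℝ → ℂ → ℝ → Fin 2 → ℂ := fun _ z μ _ => lam * z + c * μ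

/-- The solution of `ż = lam z + c u` with value `z` at time `t₀`. The input enters only through
its primitive `U`, so that the integrand is continuous. -/
def scalarResponse (lam c : ℂ) (u : ℝ → ℝ) (t₀ : ℝ) (z : ℂ) (t : ℝ) : ℂ :=
  Complex.exp (lam * t) * (Complex.exp (-lam * t₀) * z +
    ∫ s in t₀..t, Complex.exp (-lam * s) * (lam * ∫ r in t₀..s, c * u r)) +
  ∫ r in t₀..t, c * u r

theorem intervalIntegrable_const_mul_ofReal {u : ℝ → ℝ}
    (hu : ∀ a b, IntervalIntegrable u volume a b) (c : ℂ) (a b : ℝ) :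
    IntervalIntegrable (fun s => c * (u s : ℂ)) volume a b :=
  IntervalIntegrable.const_mul ⟨(hu a b).1.ofReal, (hu a b).2.ofReal⟩ c

theorem hasDerivAt_cexp_mul_ofReal (a : ℂ) (s : ℝ) :
    HasDerivAt (fun t : ℝ => Complex.exp (a * t)) (Complex.exp (a * s) * a) s := by
  simpa using (((hasDerivAt_id (s : ℂ)).const_mul a).cexp).comp_ofReal

theorem scalarResponse_self (lam c : ℂ) (u : ℝ → ℝ) (t₀ : ℝ) (z : ℂ) :
    scalarResponse lam c u t₀ z t₀ = z := by
  simp [scalarResponse, ← mul_assoc, ← Complex.exp_add]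

theorem isSolution_scalarResponse {u : ℝ → ℝ} (hu : ∀ a b, IntervalIntegrable u volume a b)
    (lam c : ℂ) (σ : ℝ → Fin 2) (t₀ : ℝ) (z : ℂ) :
    IsSolution (scalarField lam c) u σ (Ici 0) (scalarResponse lam c u t₀ z) := by
  have hcu := intervalIntegrable_const_mul_ofReal hu c
  have hU : Continuous fun t => ∫ r in t₀..t, c * (u r : ℂ) :=
    intervalIntegral.continuous_primitive hcu t₀
  have hg : Continuous fun s : ℝ =>
      Complex.exp (-lam * s) * (lam * ∫ r in t₀..s, c * (u r : ℂ)) := by fun_prop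
  set P : ℝ → ℂ := fun t => Complex.exp (lam * t) * (Complex.exp (-lam * t₀) * z +
    ∫ s in t₀..t, Complex.exp (-lam * s) * (lam * ∫ r in t₀..s, c * u r)) with hP
  have hR : ∀ t, scalarResponse lam c u t₀ z t = P t + ∫ r in t₀..t, c * (u r : ℂ) :=
    fun t => rfl
  have hderiv : ∀ t, HasDerivAt P (lam * scalarResponse lam c u t₀ z t) t := by
    intro t
    have h := (hasDerivAt_cexp_mul_ofReal lam t).mul
      ((hg.integral_hasStrictDerivAt t₀ t).hasDerivAt.const_add (Complex.exp (-lam * t₀) * z))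
    refine h.congr_deriv ?_
    have he : Complex.exp (lam * t) * Complex.exp (-lam * t) = 1 := by
      simp [← Complex.exp_add]
    rw [hR, hP]
    linear_combination (lam * ∫ r in t₀..t, c * (u r : ℂ)) * he
  have hPc : Continuous P := continuous_iff_continuousAt.2 fun t => (hderiv t).continuousAt
  have hRc : Continuous (scalarResponse lam c u t₀ z) := hPc.add hU
  have hlR : Continuous fun s => lam * scalarResponse lam c u t₀ z s := by fun_prop
  refine ⟨ordConnected_Ici, subset_rfl, nonempty_Ici, hRc.continuousOn, fun a _ b _ =>
    (hlR.intervalIntegrable a b).add (hcu a b), fun a _ b _ => ?_⟩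
  simp only [scalarField]
  rw [intervalIntegral.integral_add (hlR.intervalIntegrable a b) (hcu a b),
    intervalIntegral.integral_eq_sub_of_hasDerivAt (fun t _ => hderiv t)
      (hlR.intervalIntegrable a b), hR, hR,
    ← intervalIntegral.integral_interval_sub_left (hcu t₀ b) (hcu t₀ a)]
  ring

theorem IsSolution.eq_scalarResponse {u : ℝ → ℝ} (hu : ∀ a b, IntervalIntegrable u volume a b)
    {lam c : ℂ} {σ : ℝ → Fin 2} {D : Set ℝ} {x : ℝ → ℂ}
    (hx : IsSolution (scalarField lam c) u σ D x) {t₀ t : ℝ} (ht₀ : t₀ ∈ D) (ht : t ∈ D) :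
    x t = scalarResponse lam c u t₀ (x t₀) t := by
  have hR := isSolution_scalarResponse hu lam c σ t₀ (x t₀)
  have hsub : uIcc t₀ t ⊆ D := hx.ordConnected.uIcc_subset ht₀ ht
  set R := scalarResponse lam c u t₀ (x t₀) with hRdef
  set d : ℝ → ℂ := IccExtend (min_le_max (a := t₀) (b := t))
    ((uIcc t₀ t).domRestrict fun s => x s - R s) with hd
  have hdc : Continuous d := by
    refine Continuous.Icc_extend' (continuousOn_iff_continuous_domRestrict.1 ?_)
    exact (hx.continuousOn.mono hsub).sub
      (hR.continuousOn.mono (hsub.trans hx.subset_Ici))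
  have hdeq : ∀ s ∈ uIcc t₀ t, d s = x s - R s := fun s hs => IccExtend_of_mem _ _ hs
  set v : ℝ → ℂ := fun s => ∫ r in t₀..s, lam * d r with hv
  have hvd : ∀ s, HasDerivAt v (lam * d s) s := fun s =>
    ((continuous_const.mul hdc).integral_hasStrictDerivAt t₀ s).hasDerivAt
  have hvc : Continuous v := continuous_iff_continuousAt.2 fun s => (hvd s).continuousAt
  have hdv : ∀ s ∈ uIcc t₀ t, d s = v s := by
    intro s hs
    have hs0 := hx.subset_Ici (hsub hs)
    have ht0 := hx.subset_Ici ht₀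
    rw [hdeq s hs, hx.integral_eq t₀ ht₀ s (hsub hs), hR.integral_eq t₀ ht0 s hs0,
      hRdef, scalarResponse_self, ← hRdef, add_sub_add_left_eq_sub,
      ← intervalIntegral.integral_sub (hx.intervalIntegrable t₀ ht₀ s (hsub hs))
        (hR.intervalIntegrable t₀ ht0 s hs0)]
    refine intervalIntegral.integral_congr fun r hr => ?_
    have hr' : r ∈ uIcc t₀ t := uIcc_subset_uIcc_left hs hr
    simp only [scalarField, hdeq r hr']
    ring
  have hy : ∀ s : ℝ, HasDerivAt (fun s : ℝ => Complex.exp (-lam * s) * v s)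
      (Complex.exp (-lam * s) * (-lam) * v s + Complex.exp (-lam * s) * (lam * d s)) s :=
    fun s => (hasDerivAt_cexp_mul_ofReal (-lam) s).mul (hvd s)
  have hint := intervalIntegral.integral_eq_sub_of_hasDerivAt (a := t₀) (b := t)
    (fun s _ => hy s) (Continuous.intervalIntegrable (by fun_prop) _ _)
  have hzero : ∫ s in t₀..t, (Complex.exp (-lam * s) * (-lam) * v s +
      Complex.exp (-lam * s) * (lam * d s)) = ∫ s in t₀..t, (0 : ℂ) :=
    intervalIntegral.integral_congr fun s hs => by
      simp only [hdv s hs]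
      ring
  rw [hzero] at hint
  have hvt₀ : v t₀ = 0 := by simp [hv]
  have hvt : v t = 0 := by simpa [hvt₀, Complex.exp_ne_zero] using hint
  rw [← hdv t right_mem_uIcc, hdeq t right_mem_uIcc] at hvt
  exact sub_eq_zero.1 hvt

theorem norm_scalarResponse_le {u : ℝ → ℝ} (hu : ∀ a b, IntervalIntegrable u volume a b)
    {lam : ℂ} (hlam : lam.re = -1) (c : ℂ) (z : ℂ) {t₀ t : ℝ} (h : t₀ ≤ t) :
    ‖scalarResponse lam c u t₀ z t‖ ≤
      Real.exp (-(t - t₀)) * ‖z‖ + (‖lam‖ + 1) * ‖c‖ * ∫ s in t₀..t, ‖u s‖ := by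
  set I := ∫ s in t₀..t, ‖u s‖
  have hI : 0 ≤ I := intervalIntegral.integral_nonneg h fun _ _ => norm_nonneg _
  have hU : ∀ s ∈ Icc t₀ t, ‖∫ r in t₀..s, c * (u r : ℂ)‖ ≤ ‖c‖ * I := by
    intro s hs
    rw [intervalIntegral.integral_const_mul, norm_mul]
    refine mul_le_mul_of_nonneg_left ?_ (norm_nonneg c)
    refine (intervalIntegral.norm_integral_le_integral_norm hs.1).trans ?_
    simp only [Complex.norm_real]
    exact intervalIntegral.integral_mono_interval le_rfl hs.1 hs.2
      (Eventually.of_forall fun _ => norm_nonneg _) (hu t₀ t).norm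
  have hexp : ∀ s : ℝ, ‖Complex.exp (lam * s)‖ = Real.exp (-s) := fun s => by
    simp [Complex.norm_exp, hlam]
  have hexp' : ∀ s : ℝ, ‖Complex.exp (-lam * s)‖ = Real.exp s := fun s => by
    simp [Complex.norm_exp, hlam]
  have hint : ‖∫ s in t₀..t, Complex.exp (-lam * s) * (lam * ∫ r in t₀..s, c * (u r : ℂ))‖ ≤
      Real.exp t * (‖lam‖ * (‖c‖ * I)) := by
    have h1 := intervalIntegral.norm_integral_le_of_norm_le (μ := volume) h
      (f := fun s : ℝ => Complex.exp (-lam * s) * (lam * ∫ r in t₀..s, c * (u r : ℂ)))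
      (g := fun s => Real.exp s * (‖lam‖ * (‖c‖ * I)))
      (Eventually.of_forall fun s hs => by
        rw [norm_mul, norm_mul, hexp']
        gcongr
        exact hU s (Ioc_subset_Icc_self hs))
      (Continuous.intervalIntegrable (by fun_prop) _ _)
    refine h1.trans ?_
    rw [intervalIntegral.integral_mul_const, integral_exp]
    refine mul_le_mul_of_nonneg_right ?_ (by positivity)
    linarith [Real.exp_pos t₀]
  have he : Real.exp (-t) * Real.exp t = 1 := by simp [← Real.exp_add]
  have he' : Real.exp (-(t - t₀)) = Real.exp (-t) * Real.exp t₀ := by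
    rw [← Real.exp_add]
    ring_nf
  calc ‖scalarResponse lam c u t₀ z t‖
      ≤ Real.exp (-t) * (Real.exp t₀ * ‖z‖ + Real.exp t * (‖lam‖ * (‖c‖ * I))) + ‖c‖ * I := by
        refine (norm_add_le _ _).trans (add_le_add ?_ (hU t (right_mem_Icc.2 h)))
        rw [norm_mul, hexp]
        refine mul_le_mul_of_nonneg_left ((norm_add_le _ _).trans (add_le_add ?_ hint))
          (Real.exp_pos _).le
        rw [norm_mul, hexp']
    _ = Real.exp (-(t - t₀)) * ‖z‖ + (‖lam‖ + 1) * ‖c‖ * I := by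
        rw [he']
        linear_combination (‖lam‖ * (‖c‖ * I)) * he

theorem scalarResponse_zero_input (lam c : ℂ) (t₀ : ℝ) (z : ℂ) (t : ℝ) :
    scalarResponse lam c (fun _ => 0) t₀ z t = Complex.exp (lam * (t - t₀)) * z := by
  simp only [scalarResponse, Complex.ofReal_zero, mul_zero, intervalIntegral.integral_zero,
    add_zero, ← mul_assoc, ← Complex.exp_add]
  ring_nf

/-- The coordinate change `(ξ₁, ξ₂) ↦ a ξ₁ + i b ξ₂`. -/
def scaleToComplex (a b : ℝ) (ha : a ≠ 0) (hb : b ≠ 0) : EuclideanSpace ℝ (Fin 2) ≃L[ℝ] ℂ :=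
  LinearEquiv.toContinuousLinearEquiv
    { toFun := fun ξ => ⟨a * ξ 0, b * ξ 1⟩
      invFun := fun z => !₂[z.re / a, z.im / b]
      map_add' := fun ξ η => by apply Complex.ext <;> simp [mul_add]
      map_smul' := fun r ξ => by apply Complex.ext <;> simp [mul_left_comm]
      left_inv := fun ξ => by ext i; fin_cases i <;> simp [ha, hb]
      right_inv := fun z => by apply Complex.ext <;> simp <;> field_simp }

theorem scaleToComplex_apply (a b : ℝ) (ha : a ≠ 0) (hb : b ≠ 0) (ξ : EuclideanSpace ℝ (Fin 2)) :
    scaleToComplex a b ha hb ξ = ⟨a * ξ 0, b * ξ 1⟩ := rfl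

theorem sqrt_ten_ne_zero : √(10 : ℝ) ≠ 0 := by positivity

/-- The coordinates in which each mode is a complex scalar system. -/
def modeCoord : Fin 2 → (EuclideanSpace ℝ (Fin 2) ≃L[ℝ] ℂ) :=
  ![scaleToComplex 1 √10 one_ne_zero sqrt_ten_ne_zero,
    scaleToComplex √10 1 sqrt_ten_ne_zero one_ne_zero]

/-- The eigenvalue of each mode in the coordinates `modeCoord`. -/
def modeEigenvalue : Fin 2 → ℂ := ![⟨-1, 10 * √10⟩, ⟨-1, -(10 * √10)⟩]

/-- The input gain of each mode in the coordinates `modeCoord`. -/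
def modeGain : Fin 2 → ℂ := ![1, (√10 : ℝ)]

theorem modeCoord_exf (t : ℝ) (ξ : EuclideanSpace ℝ (Fin 2)) (μ : ℝ) (i : Fin 2) :
    modeCoord i (exf t ξ μ i) =
      scalarField (modeEigenvalue i) (modeGain i) t (modeCoord i ξ) μ i := by
  have h10 : √(10 : ℝ) * √10 = 10 := Real.mul_self_sqrt (by norm_num)
  fin_cases i <;> apply Complex.ext <;>
    simp [modeCoord, modeEigenvalue, modeGain, scalarField, scaleToComplex_apply, exf, exA, exb,
      dotProduct, Fin.sum_univ_two]
  · linear_combination (10 * ξ 1) * h10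
  · ring
  · ring
  · linear_combination (10 * ξ 0) * h10

theorem norm_le_norm_modeCoord (i : Fin 2) (ξ : EuclideanSpace ℝ (Fin 2)) :
    ‖ξ‖ ≤ ‖modeCoord i ξ‖ := by
  have h10 : √(10 : ℝ) * √10 = 10 := Real.mul_self_sqrt (by norm_num)
  rw [EuclideanSpace.norm_eq, Complex.norm_def, Complex.normSq_apply]
  apply Real.sqrt_le_sqrt
  fin_cases i <;> simp [modeCoord, scaleToComplex_apply, Fin.sum_univ_two] <;>
    nlinarith [sq_nonneg (ξ 0), sq_nonneg (ξ 1)]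

theorem norm_modeCoord_le (i : Fin 2) (ξ : EuclideanSpace ℝ (Fin 2)) :
    ‖modeCoord i ξ‖ ≤ 4 * ‖ξ‖ := by
  have h10 : √(10 : ℝ) * √10 = 10 := Real.mul_self_sqrt (by norm_num)
  refine le_of_sq_le_sq ?_ (by positivity)
  rw [mul_pow, EuclideanSpace.norm_sq_eq, Complex.sq_norm, Complex.normSq_apply]
  fin_cases i <;> simp [modeCoord, scaleToComplex_apply, Fin.sum_univ_two] <;>
    nlinarith [sq_nonneg (ξ 0), sq_nonneg (ξ 1)]

theorem sqrt_ten_lt_four : √(10 : ℝ) < 4 := by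
  rw [Real.sqrt_lt' (by norm_num)]
  norm_num

theorem norm_modeEigenvalue_le (i : Fin 2) : ‖modeEigenvalue i‖ ≤ 49 := by
  refine (Complex.norm_le_abs_re_add_abs_im _).trans ?_
  fin_cases i <;> simp [modeEigenvalue, abs_of_nonneg] <;> linarith [sqrt_ten_lt_four]

theorem norm_modeGain_le (i : Fin 2) : ‖modeGain i‖ ≤ 4 := by
  fin_cases i <;> simp [modeGain, abs_of_nonneg]
  exact sqrt_ten_lt_four.le

theorem modeEigenvalue_re (i : Fin 2) : (modeEigenvalue i).re = -1 := by
  fin_cases i <;> rfl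

theorem mem_exS_iff {σ : ℝ → Fin 2} : σ ∈ exS ↔ ∃ i, σ = fun _ => i := by
  simp [exS, Fin.exists_fin_two]

/-- The solution of mode `i` with value `ξ` at time `t₀`. -/
def modeResponse (i : Fin 2) (u : ℝ → ℝ) (t₀ : ℝ) (ξ : EuclideanSpace ℝ (Fin 2)) (t : ℝ) :
    EuclideanSpace ℝ (Fin 2) :=
  (modeCoord i).symm (scalarResponse (modeEigenvalue i) (modeGain i) ((Ici (0 : ℝ)).indicator u)
    t₀ (modeCoord i ξ) t)

theorem modeResponse_self (i : Fin 2) (u : ℝ → ℝ) (t₀ : ℝ) (ξ : EuclideanSpace ℝ (Fin 2)) :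
    modeResponse i u t₀ ξ t₀ = ξ := by
  simp [modeResponse, scalarResponse_self]

theorem isSolution_modeResponse {u : ℝ → ℝ} (hu : IsInput u) (i : Fin 2) (t₀ : ℝ)
    (ξ : EuclideanSpace ℝ (Fin 2)) :
    IsSolution exf u (fun _ => i) (Ici 0) (modeResponse i u t₀ ξ) := by
  refine (isSolution_scalarResponse hu.intervalIntegrable_indicator (modeEigenvalue i)
    (modeGain i) (fun _ => i) t₀ (modeCoord i ξ)).map_clm
      ((modeCoord i).symm : ℂ →L[ℝ] EuclideanSpace ℝ (Fin 2)) fun s hs z => ?_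
  rw [indicator_of_mem (mem_Ici.2 hs)]
  apply (modeCoord i).injective
  simp [modeCoord_exf]

theorem IsSolution.eq_modeResponse {u : ℝ → ℝ} (hu : IsInput u) {i : Fin 2} {D : Set ℝ}
    {x : ℝ → EuclideanSpace ℝ (Fin 2)} (hx : IsSolution exf u (fun _ => i) D x) {t₀ t : ℝ}
    (ht₀ : t₀ ∈ D) (ht : t ∈ D) : x t = modeResponse i u t₀ (x t₀) t := by
  have h := hx.map_clm (g := scalarField (modeEigenvalue i) (modeGain i))
    (v := (Ici (0 : ℝ)).indicator u) (τ := fun _ => i)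
    (modeCoord i : EuclideanSpace ℝ (Fin 2) →L[ℝ] ℂ) fun s hs ξ => by
      rw [indicator_of_mem (mem_Ici.2 hs)]
      exact modeCoord_exf s ξ (u s) i
  have h' := h.eq_scalarResponse hu.intervalIntegrable_indicator ht₀ ht
  exact ((modeCoord i).symm_apply_eq.2 h'.symm).symm

theorem isMaximalSolution_modeResponse {u : ℝ → ℝ} (hu : IsInput u) (i : Fin 2) (t₀ : ℝ)
    (ξ : EuclideanSpace ℝ (Fin 2)) :
    IsMaximalSolution exf u (fun _ => i) (Ici 0) (modeResponse i u t₀ ξ) :=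
  ⟨isSolution_modeResponse hu i t₀ ξ, fun _ _ h _ _ => h.subset_Ici⟩

theorem norm_modeResponse_le {u : ℝ → ℝ} (hu : IsInput u) (i : Fin 2)
    (ξ : EuclideanSpace ℝ (Fin 2)) {t₀ t : ℝ} (ht₀ : 0 ≤ t₀) (h : t₀ ≤ t) :
    ‖modeResponse i u t₀ ξ t‖ ≤
      4 * ‖ξ‖ * Real.exp (-(t - t₀)) + 200 * ∫ s in t₀..t, ‖u s‖ := by
  have hu_eq : ∫ s in t₀..t, ‖(Ici (0 : ℝ)).indicator u s‖ = ∫ s in t₀..t, ‖u s‖ := by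
    refine intervalIntegral.integral_congr fun s hs => ?_
    rw [uIcc_of_le h] at hs
    simp only [indicator_of_mem (mem_Ici.2 (ht₀.trans hs.1))]
  have hI : 0 ≤ ∫ s in t₀..t, ‖u s‖ :=
    intervalIntegral.integral_nonneg h fun _ _ => norm_nonneg _
  have hbound := norm_scalarResponse_le hu.intervalIntegrable_indicator (modeEigenvalue_re i)
    (modeGain i) (modeCoord i ξ) h
  rw [hu_eq] at hbound
  have hgain : (‖modeEigenvalue i‖ + 1) * ‖modeGain i‖ ≤ (49 + 1) * 4 := by
    gcongr
    · exact norm_modeEigenvalue_le i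
    · exact norm_modeGain_le i
  calc ‖modeResponse i u t₀ ξ t‖ ≤ ‖modeCoord i (modeResponse i u t₀ ξ t)‖ :=
        norm_le_norm_modeCoord i _
    _ ≤ Real.exp (-(t - t₀)) * ‖modeCoord i ξ‖ +
        (‖modeEigenvalue i‖ + 1) * ‖modeGain i‖ * ∫ s in t₀..t, ‖u s‖ := by
        simpa [modeResponse] using hbound
    _ ≤ Real.exp (-(t - t₀)) * (4 * ‖ξ‖) + (49 + 1) * 4 * ∫ s in t₀..t, ‖u s‖ := by
        gcongr
        exact norm_modeCoord_le i ξ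
    _ = 4 * ‖ξ‖ * Real.exp (-(t - t₀)) + 200 * ∫ s in t₀..t, ‖u s‖ := by ring

theorem classKInf_const_mul {c : ℝ} (hc : 0 < c) : ClassKInf fun r => c * r :=
  ⟨⟨by fun_prop, fun _ _ _ _ h => mul_lt_mul_of_pos_left h hc, mul_zero c⟩,
    tendsto_id.const_mul_atTop hc⟩

theorem classKL_mul_exp_neg {c : ℝ} (hc : 0 < c) : ClassKL fun r t => c * r * Real.exp (-t) := by
  refine ⟨fun t _ => ?_, fun r hr => ⟨fun s _ t _ hst => ?_, ?_⟩⟩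
  · have h := classKInf_const_mul (mul_pos hc (Real.exp_pos (-t)))
    convert h using 2
    ring
  · have : Real.exp (-t) ≤ Real.exp (-s) := Real.exp_le_exp.2 (neg_le_neg hst)
    exact mul_le_mul_of_nonneg_left this (by positivity)
  · simpa using Real.tendsto_exp_neg_atTop_nhds_zero.const_mul (c * r)

theorem iiss_exf : IISS exf exS fun r => r := by
  refine ⟨fun t₀ _ u hu σ hσ D x hx ht₀ => ?_, fun r t => 4 * r * Real.exp (-t),
    fun r => 200 * r, classKL_mul_exp_neg (by norm_num), (classKInf_const_mul (by norm_num)).1,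
    fun t₀ h0 u hu σ hσ D x hx ht₀ t ht h => ?_⟩
  · obtain ⟨i, rfl⟩ := mem_exS_iff.1 hσ
    exact (Ici_subset_Ici.2 (hx.1.subset_Ici ht₀)).trans
      (hx.2 _ _ (isSolution_modeResponse hu i t₀ (x t₀)) hx.1.subset_Ici
        fun t ht => hx.1.eq_modeResponse hu ht₀ ht)
  · obtain ⟨i, rfl⟩ := mem_exS_iff.1 hσ
    rw [hx.1.eq_modeResponse hu ht₀ ht]
    exact norm_modeResponse_le hu i _ h0 h

/-- Along the zero-input flow of either mode, a storage function does not increase. -/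
theorem ZeroODWithStorage.le_of_modeCoord_eq {V : ℝ → EuclideanSpace ℝ (Fin 2) → ℝ} {α : ℝ → ℝ}
    (hV : ZeroODWithStorage exf exS V α) (hα : α 0 = 0) (i : Fin 2) {t₀ t : ℝ} (ht₀ : 0 ≤ t₀)
    (h : t₀ ≤ t) {ξ η : EuclideanSpace ℝ (Fin 2)}
    (hη : modeCoord i η = Complex.exp (modeEigenvalue i * (t - t₀)) * modeCoord i ξ) :
    V t η ≤ V t₀ ξ := by
  have hu : IsInput fun _ : ℝ => (0 : ℝ) := ⟨measurable_const, fun _ => ⟨0, by simp⟩⟩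
  have hle := hV.2 t₀ ht₀ _ hu _ (mem_exS_iff.2 ⟨i, rfl⟩) _ _
    (isMaximalSolution_modeResponse hu i t₀ ξ) ht₀ t (ht₀.trans h) h
  have hηt : modeResponse i (fun _ => 0) t₀ ξ t = η := by
    rw [modeResponse, indicator_zero, scalarResponse_zero_input, ← hη,
      ContinuousLinearEquiv.symm_apply_apply]
  simpa [modeResponse_self, hηt, hα] using hle

/-- The time of a quarter turn in either mode. -/
def quarterTime : ℝ := Real.pi / (20 * √10)

theorem quarterTime_pos : 0 < quarterTime := by
  unfold quarterTime
  positivity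

/-- The factor by which the norm grows during a quarter turn from the short to the long axis. -/
def quarterGrowth : ℝ := √10 * Real.exp (-quarterTime)

theorem one_lt_quarterGrowth_sq : 1 < quarterGrowth ^ 2 := by
  have hT : quarterTime ≤ 1 / 2 := by
    have h1 : (1 : ℝ) ≤ √10 := Real.one_le_sqrt.2 (by norm_num)
    rw [quarterTime, div_le_iff₀ (by positivity)]
    linarith [Real.pi_lt_four]
  have hexp : (1 / 2 : ℝ) ≤ Real.exp (-quarterTime) := by
    linarith [Real.add_one_le_exp (-quarterTime)]
  rw [quarterGrowth, mul_pow, Real.sq_sqrt (by norm_num)]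
  nlinarith

theorem modeEigenvalue_zero_mul_quarterTime :
    modeEigenvalue 0 * quarterTime = (-quarterTime : ℝ) + (Real.pi / 2 : ℝ) * Complex.I := by
  have h := sqrt_ten_ne_zero
  apply Complex.ext <;> simp [modeEigenvalue]
  rw [quarterTime]
  field_simp
  norm_num

theorem modeEigenvalue_one_mul_quarterTime :
    modeEigenvalue 1 * quarterTime = (-quarterTime : ℝ) - (Real.pi / 2 : ℝ) * Complex.I := by
  have h := sqrt_ten_ne_zero
  apply Complex.ext <;> simp [modeEigenvalue]
  rw [quarterTime]
  field_simp
  norm_num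

theorem cexp_modeEigenvalue_zero_mul_quarterTime :
    Complex.exp (modeEigenvalue 0 * quarterTime) =
      (Real.exp (-quarterTime) : ℝ) * Complex.I := by
  rw [modeEigenvalue_zero_mul_quarterTime, Complex.exp_add, ← Complex.ofReal_exp,
    Complex.ofReal_div, Complex.ofReal_ofNat, Complex.exp_pi_div_two_mul_I]

theorem cexp_modeEigenvalue_one_mul_quarterTime :
    Complex.exp (modeEigenvalue 1 * quarterTime) =
      (Real.exp (-quarterTime) : ℝ) * -Complex.I := by
  rw [modeEigenvalue_one_mul_quarterTime, Complex.exp_sub, ← Complex.ofReal_exp,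
    Complex.ofReal_div, Complex.ofReal_ofNat, Complex.exp_pi_div_two_mul_I, Complex.div_I]
  ring

theorem ZeroODWithStorage.le_of_half_turn {V : ℝ → EuclideanSpace ℝ (Fin 2) → ℝ} {α : ℝ → ℝ}
    (hV : ZeroODWithStorage exf exS V α) (hα : α 0 = 0) {t : ℝ} (ht : 0 ≤ t) (a : ℝ) :
    V (t + quarterTime + quarterTime) !₂[0, quarterGrowth ^ 2 * a] ≤ V t !₂[0, a] := by
  have hT := quarterTime_pos
  refine (hV.le_of_modeCoord_eq hα 1 (t₀ := t + quarterTime) (by linarith) (by linarith)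
    (ξ := !₂[-(quarterGrowth * a), 0]) ?_).trans
    (hV.le_of_modeCoord_eq hα 0 ht (by linarith) ?_)
  · rw [← Complex.ofReal_sub, add_sub_cancel_left, cexp_modeEigenvalue_one_mul_quarterTime]
    apply Complex.ext <;> simp [-Complex.ofReal_exp, modeCoord, scaleToComplex_apply, quarterGrowth]
    ring
  · rw [← Complex.ofReal_sub, add_sub_cancel_left, cexp_modeEigenvalue_zero_mul_quarterTime]
    apply Complex.ext <;> simp [-Complex.ofReal_exp, modeCoord, scaleToComplex_apply, quarterGrowth]
    ring

theorem not_zeroOD_exf {α : ℝ → ℝ} (hα : α 0 = 0) : ¬ ZeroOD exf exS α := by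
  rintro ⟨V, -, hV⟩
  have hdesc : ∀ n : ℕ, V (n * (2 * quarterTime)) !₂[0, (quarterGrowth ^ 2) ^ n] ≤
      V 0 !₂[0, 1] := by
    intro n
    induction n with
    | zero => simp
    | succ n ih =>
      have ht : 0 ≤ n * (2 * quarterTime) := by have := quarterTime_pos; positivity
      have h := (hV.le_of_half_turn hα ht ((quarterGrowth ^ 2) ^ n)).trans ih
      rw [pow_succ', show ((n + 1 : ℕ) : ℝ) * (2 * quarterTime) =
        n * (2 * quarterTime) + quarterTime + quarterTime by push_cast; ring]
      exact h
  obtain ⟨φ₁, φ₂, hφ₁, -, hbound⟩ := hV.1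
  have hnorm : ∀ n : ℕ, ‖(!₂[0, (quarterGrowth ^ 2) ^ n] : EuclideanSpace ℝ (Fin 2))‖ =
      (quarterGrowth ^ 2) ^ n := fun n => by
    rw [EuclideanSpace.norm_eq]
    simpa [Fin.sum_univ_two] using Real.sqrt_sq (by positivity)
  have hlim := hφ₁.2.comp (tendsto_pow_atTop_atTop_of_one_lt one_lt_quarterGrowth_sq)
  obtain ⟨n, hn⟩ := (hlim.eventually_gt_atTop (V 0 !₂[0, 1])).exists
  have ht : 0 ≤ n * (2 * quarterTime) := by have := quarterTime_pos; positivity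
  have h := (hbound _ ht !₂[0, (quarterGrowth ^ 2) ^ n]).1
  rw [hnorm] at h
  exact absurd (h.trans (hdesc n)) (not_le.2 hn)

/-- Proposition `onlysuff`: the above two-mode switched linear system is
iISS w.r.t. `S = {σ₁, σ₂}` (the constant switching signals) but not 0-OD w.r.t. `S`. -/
theorem stmt16 :
    (∃ χ : ℝ → ℝ, ClassK χ ∧ IISS exf exS χ) ∧
    ¬ (∃ α : ℝ → ℝ, ClassK α ∧ ZeroOD exf exS α) :=
  ⟨⟨fun r => r, ⟨continuousOn_id, strictMonoOn_id, rfl⟩, iiss_exf⟩,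
    fun ⟨_, hα, hOD⟩ => not_zeroOD_exf hα.2.2 hOD⟩
end
end
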